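/- Let n ≥ 1, σ > 0, c > 0, R₀ > 0, let s ∈ ℝ, α ∈ [1, ∞), r ∈ [1, 2], and ℓ > n(1/r − 1/2) (with ℓ ≥ 0 allowed when r = 2). Then there exists a constant C > 0 such that for every family (f_q)_{q∈ℤ} of Schwartz functions on ℝⁿ with supp \hat{f_q} ⊆ A_q for every q, and every t ≥ 0: ( Σ_{q ∈ ℤ, 2^q ≥ R₀} ( 2^{qs} ‖\hat{f_q}(·) e^{−c t |·|^{−σ}}‖_{L²(ℝⁿ)} )^α )^{1/α} ≤ C (1+t)^{−ℓ/σ + (n/σ)(1/r − 1/2)} ( Σ_{q∈ℤ} ( 2^{q(s+ℓ)} ‖f_q‖_{L^r(ℝⁿ)} )^α )^{1/α}, whenever the right-hand side is finite. -/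

import Mathlib

open MeasureTheory Real
open scoped FourierTransform ENNReal NNReal

noncomputable section

/-- Powers of `a + y` are absorbed by exponential decay in `y`. -/
lemma exists_rpow_add_mul_exp_neg_le {p k a : ℝ} (hp : 0 ≤ p) (hk : 0 < k) (ha : 0 ≤ a) :
    ∃ M : ℝ, 0 < M ∧ ∀ y : ℝ, 0 ≤ y → (a + y) ^ p * exp (-(k * y)) ≤ M := by
  refine ⟨((p + 1) / k) ^ p * exp (k * a), by positivity, fun y hy => ?_⟩
  have hz : 0 ≤ a + y := by positivity
  have hlin : a + y ≤ (p + 1) / k * exp (k * (a + y) / (p + 1)) := by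
    have h := add_one_le_exp (k * (a + y) / (p + 1))
    calc a + y = (p + 1) / k * (k * (a + y) / (p + 1)) := by field_simp
      _ ≤ _ := by gcongr; linarith
  have hpow : (a + y) ^ p ≤ ((p + 1) / k) ^ p * exp (k * (a + y)) := by
    calc (a + y) ^ p ≤ ((p + 1) / k * exp (k * (a + y) / (p + 1))) ^ p := by gcongr
      _ = ((p + 1) / k) ^ p * exp (k * (a + y) / (p + 1) * p) := by
        rw [mul_rpow (by positivity) (by positivity), ← exp_mul]
      _ ≤ _ := by
        refine mul_le_mul_of_nonneg_left (exp_le_exp.2 ?_) (by positivity)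
        rw [div_mul_eq_mul_div, div_le_iff₀ (by positivity)]
        have : 0 ≤ k * (a + y) := by positivity
        linarith
  calc (a + y) ^ p * exp (-(k * y))
      ≤ ((p + 1) / k) ^ p * exp (k * (a + y)) * exp (-(k * y)) := by gcongr
    _ = _ := by rw [mul_assoc, ← exp_add]; congr 2; ring

/-- Uniformly for `0 < x ≤ a`, the product `x ^ β * exp (-k t x ^ σ)` decays like
`(1 + t) ^ (-β / σ)`. -/
lemma exists_rpow_mul_exp_neg_rpow_le {β σ k a : ℝ} (hβ : 0 ≤ β) (hσ : 0 < σ) (hk : 0 < k)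
    (ha : 0 ≤ a) :
    ∃ M : ℝ, 0 < M ∧ ∀ x t : ℝ, 0 < x → x ≤ a → 0 ≤ t →
      x ^ β * exp (-(k * (t * x ^ σ))) ≤ M * (1 + t) ^ (-β / σ) := by
  obtain ⟨M, hM, h⟩ := exists_rpow_add_mul_exp_neg_le (p := β / σ) (k := k) (a := a ^ σ)
    (by positivity) hk (by positivity)
  refine ⟨M, hM, fun x t hx hxa ht => ?_⟩
  rw [neg_div, rpow_neg (by positivity), ← div_eq_mul_inv, le_div_iff₀ (by positivity)]
  calc x ^ β * exp (-(k * (t * x ^ σ))) * (1 + t) ^ (β / σ)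
      = (x ^ σ * (1 + t)) ^ (β / σ) * exp (-(k * (t * x ^ σ))) := by
        rw [mul_rpow (by positivity) (by positivity), ← rpow_mul hx.le, mul_div_cancel₀ _ hσ.ne']
        ring
    _ ≤ (a ^ σ + t * x ^ σ) ^ (β / σ) * exp (-(k * (t * x ^ σ))) := by
        have : x ^ σ ≤ a ^ σ := rpow_le_rpow hx.le hxa hσ.le
        gcongr
        linarith
    _ ≤ M := h _ (by positivity)

section Bernstein

variable {V : Type*} [NormedAddCommGroup V] [InnerProductSpace ℝ V] [FiniteDimensional ℝ V]
  [MeasurableSpace V] [BorelSpace V]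

/-- Plancherel's theorem for Schwartz functions, in terms of `eLpNorm`. -/
lemma SchwartzMap.eLpNorm_fourier_two (f : SchwartzMap V ℂ) :
    eLpNorm (𝓕 ⇑f) 2 volume = eLpNorm ⇑f 2 volume := by
  have h := f.norm_fourier_toL2_eq
  rw [norm_toLp, norm_toLp] at h
  have hfin (g : SchwartzMap V ℂ) : eLpNorm ⇑g 2 volume ≠ ⊤ := (g.eLpNorm_lt_top 2 volume).ne
  rw [← fourier_coe]
  exact (ENNReal.toReal_eq_toReal_iff' (hfin _) (hfin _)).1 h

/-- A Schwartz function whose spectrum lies in `S` is bounded by `|S| ^ (1 / 2)` times its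
`L²` norm. -/
lemma SchwartzMap.enorm_le_of_support_fourier_subset (f : SchwartzMap V ℂ) {S : Set V}
    (hS : Function.support (𝓕 ⇑f) ⊆ S) (x : V) :
    ‖f x‖ₑ ≤ volume S ^ (1 / 2 : ℝ) * eLpNorm ⇑f 2 volume := by
  have hinv : f x = ∫ v, 𝐞 (inner ℝ v x) • 𝓕 (⇑f) v := by
    rw [← Real.fourierInv_eq]
    exact congrFun (f.continuous.fourierInv_fourier_eq f.integrable (𝓕 f).integrable).symm x
  calc ‖f x‖ₑ ≤ ∫⁻ v, ‖𝐞 (inner ℝ v x) • 𝓕 (⇑f) v‖ₑ := by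
        rw [hinv]; exact enorm_integral_le_lintegral_enorm _
    _ = eLpNorm (𝓕 ⇑f) 1 (volume.restrict S) := by
        rw [eLpNorm_restrict_eq_of_support_subset hS, eLpNorm_one_eq_lintegral_enorm]
        refine lintegral_congr fun v => ?_
        rw [← ofReal_norm, ← ofReal_norm, Circle.norm_smul]
    _ ≤ eLpNorm (𝓕 ⇑f) 2 (volume.restrict S) *
          volume.restrict S Set.univ ^ (1 / (1 : ℝ≥0∞).toReal - 1 / (2 : ℝ≥0∞).toReal) :=
        eLpNorm_le_eLpNorm_mul_rpow_measure_univ (by norm_num)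
          (𝓕 f).continuous.aestronglyMeasurable
    _ = _ := by
        rw [eLpNorm_restrict_eq_of_support_subset hS, eLpNorm_fourier_two,
          Measure.restrict_apply_univ, mul_comm]
        norm_num

/-- Bernstein's inequality from `Lʳ` to `L²`, for `1 ≤ r ≤ 2`. -/
lemma SchwartzMap.eLpNorm_two_le_of_support_fourier_subset (f : SchwartzMap V ℂ) {S : Set V}
    (hS : Function.support (𝓕 ⇑f) ⊆ S) (hvol : volume S ≠ ⊤) {r : ℝ} (hr1 : 1 ≤ r) (hr2 : r ≤ 2) :
    eLpNorm ⇑f 2 volume ≤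
      volume S ^ (1 / r - 1 / 2) * eLpNorm ⇑f (ENNReal.ofReal r) volume := by
  have hr0 : 0 < r := by linarith
  set A := eLpNorm ⇑f 2 volume with hA
  have hAtop : A ≠ ⊤ := (f.eLpNorm_lt_top 2 volume).ne
  rcases eq_or_ne A 0 with h0 | h0
  · simp [h0]
  have hB : eLpNorm ⇑f (ENNReal.ofReal r) volume = (∫⁻ x, ‖f x‖ₑ ^ r) ^ (1 / r) := by
    rw [eLpNorm_eq_lintegral_rpow_enorm_toReal (by simpa using hr0) (by simp),
      ENNReal.toReal_ofReal hr0.le]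
  have hA2 : A ^ (2 : ℝ) = ∫⁻ x, ‖f x‖ₑ ^ (2 : ℝ) := by
    rw [hA, eLpNorm_eq_lintegral_rpow_enorm_toReal (by simp) (by simp), ← ENNReal.rpow_mul]
    simp
  have hinterp : A ^ r * A ^ (2 - r) ≤
      volume S ^ (1 - r / 2) * (∫⁻ x, ‖f x‖ₑ ^ r) * A ^ (2 - r) := by
    calc A ^ r * A ^ (2 - r) = ∫⁻ x, ‖f x‖ₑ ^ (2 : ℝ) := by
          rw [← ENNReal.rpow_add _ _ h0 hAtop, ← hA2]; congr 1; ring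
      _ ≤ ∫⁻ x, (volume S ^ (1 / 2 : ℝ) * A) ^ (2 - r) * ‖f x‖ₑ ^ r := by
          refine lintegral_mono fun x => ?_
          calc ‖f x‖ₑ ^ (2 : ℝ) = ‖f x‖ₑ ^ (2 - r) * ‖f x‖ₑ ^ r := by
                rw [← ENNReal.rpow_add_of_nonneg _ _ (by linarith) hr0.le]; congr 1; ring
            _ ≤ _ := by
                gcongr
                exact f.enorm_le_of_support_fourier_subset hS x
      _ = _ := by
          rw [lintegral_const_mul' _ _ (ENNReal.rpow_ne_top_of_nonneg (by linarith)
              (ENNReal.mul_ne_top (ENNReal.rpow_ne_top_of_nonneg (by norm_num) hvol) hAtop)),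
            ENNReal.mul_rpow_of_nonneg _ _ (by linarith), ← ENNReal.rpow_mul]
          rw [show 1 / 2 * (2 - r) = 1 - r / 2 by ring]
          ring
  have hpos : A ^ (2 - r) ≠ 0 := (ENNReal.rpow_pos h0.bot_lt hAtop).ne'
  have hAr := (ENNReal.mul_le_mul_iff_left hpos
    (ENNReal.rpow_ne_top_of_nonneg (by linarith) hAtop)).1 hinterp
  calc A = (A ^ r) ^ (1 / r) := by rw [← ENNReal.rpow_mul, mul_one_div_cancel hr0.ne']; simp
    _ ≤ (volume S ^ (1 - r / 2) * ∫⁻ x, ‖f x‖ₑ ^ r) ^ (1 / r) := by gcongr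
    _ = _ := by
        rw [ENNReal.mul_rpow_of_nonneg _ _ (by positivity), ← ENNReal.rpow_mul, hB]
        congr 2
        field_simp

end Bernstein

/-- Bernstein's inequality at dyadic frequency `2 ^ q`. -/
lemma exists_eLpNorm_two_le_of_dyadic_support (n : ℕ) {r : ℝ} (hr1 : 1 ≤ r) (hr2 : r ≤ 2) :
    ∃ D : ℝ, 0 < D ∧ ∀ (q : ℤ) (f : SchwartzMap (EuclideanSpace ℝ (Fin n)) ℂ),
      Function.support (𝓕 ⇑f) ⊆ Metric.closedBall 0 ((8 / 3 : ℝ) * 2 ^ q) →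
      eLpNorm ⇑f 2 volume ≤ ENNReal.ofReal (D * (2 : ℝ) ^ ((q : ℝ) * (n * (1 / r - 1 / 2)))) *
        eLpNorm ⇑f (ENNReal.ofReal r) volume := by
  set e := 1 / r - 1 / 2 with he
  have he0 : 0 ≤ e := sub_nonneg.2 (one_div_le_one_div_of_le (by linarith) hr2)
  set v := (volume (Metric.ball (0 : EuclideanSpace ℝ (Fin n)) 1)).toReal with hv
  have hv0 : 0 < v := ENNReal.toReal_pos (Metric.measure_ball_pos _ _ one_pos).ne'
    measure_ball_lt_top.ne
  refine ⟨((8 / 3 : ℝ) ^ n * v) ^ e, by positivity, fun q f hf => ?_⟩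
  refine (f.eLpNorm_two_le_of_support_fourier_subset hf measure_closedBall_lt_top.ne
    hr1 hr2).trans_eq ?_
  rw [Measure.addHaar_closedBall _ _ (by positivity), finrank_euclideanSpace_fin,
    ← ENNReal.ofReal_toReal (measure_ball_lt_top (x := (0 : EuclideanSpace ℝ (Fin n)))
      (r := 1)).ne, ← hv, ← ENNReal.ofReal_mul (by positivity),
    ENNReal.ofReal_rpow_of_pos (by positivity)]
  congr 2
  have h2q : (0 : ℝ) ≤ 2 ^ q := zpow_nonneg two_pos.le q
  rw [mul_pow, mul_right_comm, mul_rpow (by positivity) (pow_nonneg h2q n)]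
  congr 1
  rw [← rpow_natCast, ← rpow_intCast, ← rpow_mul two_pos.le, ← rpow_mul two_pos.le,
    mul_assoc]

/-- The summed high-frequency half of the frequency-localization time-decay inequality of
Theorem 1.1, for a dissipative rate behaving like `c|ξ|^{-σ}` at high frequencies. -/
theorem summed_high_freq_decay
    (n : ℕ) (hn : 1 ≤ n) (σ c R₀ : ℝ) (hσ : 0 < σ) (hc : 0 < c) (hR₀ : 0 < R₀)
    (s : ℝ) (α : ℝ) (hα : 1 ≤ α) (r : ℝ) (hr1 : 1 ≤ r) (hr2 : r ≤ 2)
    (ℓ : ℝ) (hℓ : (n : ℝ) * (1 / r - 1 / 2) < ℓ ∨ (r = 2 ∧ 0 ≤ ℓ)) :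
    ∃ C : ℝ≥0, 0 < C ∧
      ∀ f : ℤ → SchwartzMap (EuclideanSpace ℝ (Fin n)) ℂ,
        (∀ q : ℤ, Function.support (𝓕 ⇑(f q)) ⊆
          {ξ : EuclideanSpace ℝ (Fin n) | (3 / 4 : ℝ) * 2 ^ q ≤ ‖ξ‖ ∧ ‖ξ‖ ≤ (8 / 3 : ℝ) * 2 ^ q}) →
        (∑' q : ℤ, ((2 : ℝ≥0∞) ^ ((q : ℝ) * (s + ℓ)) *
            eLpNorm (⇑(f q)) (ENNReal.ofReal r) volume) ^ α) ≠ ⊤ →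
        ∀ t : ℝ, 0 ≤ t →
          (∑' q : {q : ℤ // R₀ ≤ (2 : ℝ) ^ q}, ((2 : ℝ≥0∞) ^ ((q.1 : ℝ) * s) *
              eLpNorm (fun ξ : EuclideanSpace ℝ (Fin n) =>
                Real.exp (-(c * t) * ‖ξ‖ ^ (-σ)) • 𝓕 (⇑(f q.1)) ξ) 2 volume) ^ α) ^ (1 / α)
            ≤ C * ENNReal.ofReal ((1 + t) ^ (-ℓ / σ + (n : ℝ) / σ * (1 / r - 1 / 2))) *
                (∑' q : ℤ, ((2 : ℝ≥0∞) ^ ((q : ℝ) * (s + ℓ)) *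
                  eLpNorm (⇑(f q)) (ENNReal.ofReal r) volume) ^ α) ^ (1 / α) := by
  have hr0 : 0 < r := by linarith
  set δ := (n : ℝ) * (1 / r - 1 / 2) with hδ
  have hβ : 0 ≤ ℓ - δ := by
    rcases hℓ with h | ⟨h, h'⟩
    · linarith
    · simpa [hδ, h] using h'
  obtain ⟨D, hD, hBernstein⟩ := exists_eLpNorm_two_le_of_dyadic_support n hr1 hr2
  obtain ⟨M, hM, hdecay⟩ := exists_rpow_mul_exp_neg_rpow_le (k := c * (8 / 3 : ℝ) ^ (-σ))
    (a := R₀⁻¹) hβ hσ (by positivity) (by positivity)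
  refine ⟨(D * M).toNNReal, by simpa using mul_pos hD hM, fun f hf _ t ht => ?_⟩
  set E := (1 + t) ^ (-ℓ / σ + (n : ℝ) / σ * (1 / r - 1 / 2)) with hE
  have hE' : E = (1 + t) ^ (-(ℓ - δ) / σ) := by
    rw [hE, hδ]; congr 1; field_simp; ring
  have hE0 : 0 < E := by positivity
  have hterm : ∀ q : {q : ℤ // R₀ ≤ (2 : ℝ) ^ q}, (2 : ℝ≥0∞) ^ ((q.1 : ℝ) * s) *
      eLpNorm (fun ξ : EuclideanSpace ℝ (Fin n) =>
        Real.exp (-(c * t) * ‖ξ‖ ^ (-σ)) • 𝓕 (⇑(f q.1)) ξ) 2 volume ≤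
      ENNReal.ofReal (D * M * E) * ((2 : ℝ≥0∞) ^ ((q.1 : ℝ) * (s + ℓ)) *
        eLpNorm (⇑(f q.1)) (ENNReal.ofReal r) volume) := by
    rintro ⟨q, hq⟩
    set x : ℝ := 2 ^ (-(q : ℝ)) with hx
    have hx0 : 0 < x := by positivity
    have hxR : x ≤ R₀⁻¹ := by
      rw [hx, rpow_neg (by norm_num), rpow_intCast]
      exact inv_anti₀ hR₀ hq
    have hdamp : eLpNorm (fun ξ : EuclideanSpace ℝ (Fin n) =>
        Real.exp (-(c * t) * ‖ξ‖ ^ (-σ)) • 𝓕 (⇑(f q)) ξ) 2 volume ≤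
        ENNReal.ofReal (exp (-(c * (8 / 3 : ℝ) ^ (-σ) * (t * x ^ σ)))) *
          eLpNorm (⇑(f q)) 2 volume := by
      rw [← SchwartzMap.eLpNorm_fourier_two]
      refine eLpNorm_le_mul_eLpNorm_of_ae_le_mul (.of_forall fun ξ => ?_) 2
      rw [norm_smul, norm_of_nonneg (exp_pos _).le]
      rcases eq_or_ne (𝓕 (⇑(f q)) ξ) 0 with h0 | h0
      · simp [h0]
      obtain ⟨hlo, hhi⟩ := hf q h0
      have hξ : 0 < ‖ξ‖ := lt_of_lt_of_le (by positivity) hlo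
      have hpow : (8 / 3 : ℝ) ^ (-σ) * x ^ σ ≤ ‖ξ‖ ^ (-σ) := by
        calc (8 / 3 : ℝ) ^ (-σ) * x ^ σ = ((8 / 3 : ℝ) * 2 ^ q) ^ (-σ) := by
              rw [mul_rpow (by norm_num) (by positivity), hx, ← rpow_intCast,
                ← rpow_mul (by norm_num), ← rpow_mul (by norm_num)]
              congr 2; ring
          _ ≤ _ := rpow_le_rpow_of_nonpos hξ hhi (by linarith)
      gcongr
      have := mul_le_mul_of_nonneg_left hpow (mul_nonneg hc.le ht)
      linarith
    have hball : Function.support (𝓕 ⇑(f q)) ⊆ Metric.closedBall 0 ((8 / 3 : ℝ) * 2 ^ q) :=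
      fun ξ hξ => by simpa using (hf q hξ).2
    have htwo (y : ℝ) : (2 : ℝ≥0∞) ^ y = ENNReal.ofReal (2 ^ y) := by
      rw [← ENNReal.ofReal_rpow_of_pos two_pos]; simp
    have hreal : (2 : ℝ) ^ ((q : ℝ) * s) * (exp (-(c * (8 / 3 : ℝ) ^ (-σ) * (t * x ^ σ))) *
        (D * 2 ^ ((q : ℝ) * δ))) ≤ D * M * E * 2 ^ ((q : ℝ) * (s + ℓ)) := by
      have hsplit : (2 : ℝ) ^ ((q : ℝ) * s) * 2 ^ ((q : ℝ) * δ) =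
          x ^ (ℓ - δ) * 2 ^ ((q : ℝ) * (s + ℓ)) := by
        rw [hx, ← rpow_mul (by norm_num), ← rpow_add two_pos, ← rpow_add two_pos]
        congr 1; ring
      calc _ = D * (x ^ (ℓ - δ) * exp (-(c * (8 / 3 : ℝ) ^ (-σ) * (t * x ^ σ)))) *
            2 ^ ((q : ℝ) * (s + ℓ)) := by
            linear_combination D * exp (-(c * (8 / 3 : ℝ) ^ (-σ) * (t * x ^ σ))) * hsplit
        _ ≤ D * (M * E) * 2 ^ ((q : ℝ) * (s + ℓ)) := by
            have := hdecay x t hx0 hxR ht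
            rw [← hE'] at this
            exact mul_le_mul_of_nonneg_right (mul_le_mul_of_nonneg_left this hD.le) (by positivity)
        _ = _ := by ring
    calc _ ≤ (2 : ℝ≥0∞) ^ ((q : ℝ) * s) *
          (ENNReal.ofReal (exp (-(c * (8 / 3 : ℝ) ^ (-σ) * (t * x ^ σ)))) *
            (ENNReal.ofReal (D * (2 : ℝ) ^ ((q : ℝ) * δ)) *
              eLpNorm (⇑(f q)) (ENNReal.ofReal r) volume)) := by
          gcongr
          exact hdamp.trans (by gcongr; exact hBernstein q (f q) hball)
      _ = ENNReal.ofReal ((2 : ℝ) ^ ((q : ℝ) * s) *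
            (exp (-(c * (8 / 3 : ℝ) ^ (-σ) * (t * x ^ σ))) * (D * 2 ^ ((q : ℝ) * δ)))) *
              eLpNorm (⇑(f q)) (ENNReal.ofReal r) volume := by
          rw [htwo, ENNReal.ofReal_mul (p := (2 : ℝ) ^ ((q : ℝ) * s)) (by positivity),
            ENNReal.ofReal_mul (exp_nonneg _)]
          simp only [mul_assoc]
      _ ≤ ENNReal.ofReal (D * M * E * 2 ^ ((q : ℝ) * (s + ℓ))) *
            eLpNorm (⇑(f q)) (ENNReal.ofReal r) volume := by gcongr
      _ = _ := by rw [htwo, ENNReal.ofReal_mul (by positivity), mul_assoc]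
  have hα0 : 0 < α := by linarith
  set b : ℤ → ℝ≥0∞ := fun q => ((2 : ℝ≥0∞) ^ ((q : ℝ) * (s + ℓ)) *
    eLpNorm (⇑(f q)) (ENNReal.ofReal r) volume) ^ α
  calc _ ≤ (∑' q : {q : ℤ // R₀ ≤ (2 : ℝ) ^ q},
        ENNReal.ofReal (D * M * E) ^ α * b q.1) ^ (1 / α) := by
        gcongr with q
        rw [← ENNReal.mul_rpow_of_nonneg _ _ hα0.le]
        exact ENNReal.rpow_le_rpow (hterm q) hα0.le
    _ ≤ (ENNReal.ofReal (D * M * E) ^ α * ∑' q, b q) ^ (1 / α) := by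
        rw [ENNReal.tsum_mul_left]
        gcongr
        exact ENNReal.tsum_comp_le_tsum_of_injective Subtype.val_injective b
    _ = _ := by
        rw [ENNReal.mul_rpow_of_nonneg _ _ (by positivity), ← ENNReal.rpow_mul,
          mul_one_div_cancel hα0.ne', ENNReal.rpow_one, ENNReal.ofReal_mul (by positivity)]
        rfl
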